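/- arXiv:2207.06200 — 15 statements merged into one kernel-verified Lean document; each statement's English description precedes it below -/
import Mathlib

section
/- Let A be a vector space over a field of characteristic 0 equipped with a bilinear operation ∘ : A ⊗ A → A, and set [x,y] = x∘y − y∘x. Then the following are equivalent: (1) (A,∘) is an anti-pre-Lie algebra, i.e. x∘(y∘z) − y∘(x∘z) = [y,x]∘z and [x,y]∘z + [y,z]∘x + [z,x]∘y = 0 for all x,y,z ∈ A; (2) x∘(y∘z) − y∘(x∘z) = [y,x]∘z and x∘[y,z] + y∘[z,x] + z∘[x,y] = 0 for all x,y,z ∈ A; (3) the commutator [−,−] satisfies the Jacobi identity (so (A,[−,−]) is a Lie algebra) and the left multiplication operators L(x)y = x∘y satisfy L(x)L(y) − L(y)L(x) = −L([x,y]) for all x,y ∈ A (i.e. x ↦ −L(x) is a representation of the commutator Lie algebra on A). -/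
/-- The commutator `[x,y] = x∘y − y∘x` of a bilinear operation. -/
def brkt {F A : Type*} [Field F] [AddCommGroup A] [Module F A]
    (c : A →ₗ[F] A →ₗ[F] A) (x y : A) : A := c x y - c y x

theorem brkt_swap {F A : Type*} [Field F] [AddCommGroup A] [Module F A]
    (c : A →ₗ[F] A →ₗ[F] A) (x y : A) : brkt c y x = -brkt c x y := by
  simp [brkt]

/-- Summing the first anti-pre-Lie identity cyclically relates the two cyclic sums. -/
theorem cyclic_left_eq_neg_cyclic_right {F A : Type*} [Field F] [AddCommGroup A] [Module F A]
    (c : A →ₗ[F] A →ₗ[F] A)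
    (h : ∀ x y z : A, c x (c y z) - c y (c x z) = c (brkt c y x) z) (x y z : A) :
    c x (brkt c y z) + c y (brkt c z x) + c z (brkt c x y) =
      -(c (brkt c x y) z + c (brkt c y z) x + c (brkt c z x) y) := by
  have h₁ := h x y z
  have h₂ := h y z x
  have h₃ := h z x y
  rw [brkt_swap, map_neg, LinearMap.neg_apply] at h₁ h₂ h₃
  have e : c x (brkt c y z) + c y (brkt c z x) + c z (brkt c x y) =
      (c x (c y z) - c y (c x z)) + (c y (c z x) - c z (c y x)) +
        (c z (c x y) - c x (c z y)) := by
    simp only [brkt, map_sub]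
    abel
  rw [e, h₁, h₂, h₃]
  abel

/-- Under the first anti-pre-Lie identity, the Jacobiator of the commutator is twice the
cyclic sum of `[x,y]∘z`. -/
theorem jacobiator_eq_two_smul {F A : Type*} [Field F] [AddCommGroup A] [Module F A]
    (c : A →ₗ[F] A →ₗ[F] A)
    (h : ∀ x y z : A, c x (c y z) - c y (c x z) = c (brkt c y x) z) (x y z : A) :
    brkt c (brkt c x y) z + brkt c (brkt c y z) x + brkt c (brkt c z x) y =
      (2 : F) • (c (brkt c x y) z + c (brkt c y z) x + c (brkt c z x) y) := by
  have e : brkt c (brkt c x y) z + brkt c (brkt c y z) x + brkt c (brkt c z x) y =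
      (c (brkt c x y) z + c (brkt c y z) x + c (brkt c z x) y) -
        (c x (brkt c y z) + c y (brkt c z x) + c z (brkt c x y)) := by
    rw [brkt.eq_1 c (brkt c x y), brkt.eq_1 c (brkt c y z), brkt.eq_1 c (brkt c z x)]
    abel
  rw [e, cyclic_left_eq_neg_cyclic_right c h, two_smul, sub_neg_eq_add]

/-- characterization of anti-pre-Lie algebras. -/
theorem statement0 {F A : Type*} [Field F] [CharZero F]
    [AddCommGroup A] [Module F A] (c : A →ₗ[F] A →ₗ[F] A) :
    List.TFAE
      [ -- (1) anti-pre-Lie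
        (∀ x y z : A, c x (c y z) - c y (c x z) = c (brkt c y x) z) ∧
          (∀ x y z : A, c (brkt c x y) z + c (brkt c y z) x + c (brkt c z x) y = 0),
        -- (2) first identity and x∘[y,z] + y∘[z,x] + z∘[x,y] = 0
        (∀ x y z : A, c x (c y z) - c y (c x z) = c (brkt c y x) z) ∧
          (∀ x y z : A, c x (brkt c y z) + c y (brkt c z x) + c z (brkt c x y) = 0),
        -- (3) Lie-admissibility (Jacobi identity for the commutator) and
        --     L(x)L(y) − L(y)L(x) = −L([x,y])
        (∀ x y z : A,
            brkt c (brkt c x y) z + brkt c (brkt c y z) x + brkt c (brkt c z x) y = 0) ∧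
          (∀ x y z : A, c x (c y z) - c y (c x z) = - c (brkt c x y) z) ] := by
  tfae_have 1 ↔ 2 := and_congr_right fun h => by
    simp only [cyclic_left_eq_neg_cyclic_right c h, neg_eq_zero]
  tfae_have 1 ↔ 3 := by
    have e : (∀ x y z : A, c x (c y z) - c y (c x z) = - c (brkt c x y) z) ↔
        ∀ x y z : A, c x (c y z) - c y (c x z) = c (brkt c y x) z :=
      forall₃_congr fun x y z => by rw [brkt_swap c x y, map_neg, LinearMap.neg_apply]
    rw [e, and_comm (b := ∀ x y z : A, c x (c y z) - c y (c x z) = c (brkt c y x) z)]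
    refine and_congr_right fun h => ?_
    simp only [jacobiator_eq_two_smul c h, smul_eq_zero, two_ne_zero, false_or]
  tfae_finish
end

section
/- Let A be a vector space of dimension n ≥ 2 over a field 𝔽 of characteristic 0, and let f, g : A → 𝔽 be two linear functionals. Define a bilinear operation ∘ : A ⊗ A → A by x∘y = f(y)x + g(x)y for all x,y ∈ A. Then (A,∘) is an anti-pre-Lie algebra if and only if f = 0 or g = 2f. -/
/-- On a space of dimension at least two every linear functional kills a nonzero vector. -/
theorem exists_ne_zero_apply_eq_zero {F A : Type*} [Field F]
    [AddCommGroup A] [Module F A] [FiniteDimensional F A]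
    (hdim : 2 ≤ Module.finrank F A) (f : A →ₗ[F] F) : ∃ v : A, v ≠ 0 ∧ f v = 0 := by
  have hker : LinearMap.ker f ≠ ⊥ :=
    LinearMap.ker_ne_bot_of_finrank_lt (by rw [Module.finrank_self]; omega)
  obtain ⟨v, hv, hv0⟩ := Submodule.exists_mem_ne_zero_of_ne_bot hker
  exact ⟨v, hv0, hv⟩

/-- for `x∘y = f(y)x + g(x)y` on a space of dimension `≥ 2`,
`(A,∘)` is anti-pre-Lie iff `f = 0` or `g = 2f`. -/
theorem statement2 {F A : Type*} [Field F] [CharZero F]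
    [AddCommGroup A] [Module F A] [FiniteDimensional F A]
    (hdim : 2 ≤ Module.finrank F A)
    (f g : A →ₗ[F] F) (c : A →ₗ[F] A →ₗ[F] A)
    (hc : ∀ x y : A, c x y = f y • x + g x • y) :
    ((∀ x y z : A, c x (c y z) - c y (c x z) = c (brkt c y x) z) ∧
      (∀ x y z : A, c (brkt c x y) z + c (brkt c y z) x + c (brkt c z x) y = 0))
    ↔ (f = 0 ∨ g = (2 : F) • f) := by
  constructor
  · rintro ⟨h, -⟩
    refine or_iff_not_imp_left.mpr fun hf => ?_
    obtain ⟨a, ha⟩ : ∃ a, f a ≠ 0 := by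
      by_contra! H
      exact hf (LinearMap.ext H)
    obtain ⟨e, he⟩ : ∃ e, f e = 1 := ⟨(f a)⁻¹ • a, by simp [ha]⟩
    have key : ∀ v, f v = 0 → (2 - g e) • v + (2 * g v) • e = 0 := by
      intro v hv
      have := h v e e
      simp only [brkt, hc, map_add, map_sub, map_smul, smul_eq_mul, LinearMap.add_apply,
        LinearMap.sub_apply, LinearMap.smul_apply, he, hv] at this
      linear_combination (norm := module) this
    have gker : ∀ v, f v = 0 → g v = 0 := by
      intro v hv
      have := congrArg f (key v hv)
      simpa [hv, he] using this
    obtain ⟨v, hv0, hv⟩ := exists_ne_zero_apply_eq_zero hdim f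
    have ge : g e = 2 := by
      have := key v hv
      rw [gker v hv, mul_zero, zero_smul, add_zero] at this
      exact (sub_eq_zero.mp ((smul_eq_zero.mp this).resolve_right hv0)).symm
    ext x
    have := gker (x - f x • e) (by simp [he])
    simp only [map_sub, map_smul, smul_eq_mul, ge] at this
    simp only [LinearMap.smul_apply, smul_eq_mul]
    linear_combination this
  · rintro (rfl | rfl) <;> constructor <;> intro x y z <;>
      simp only [brkt, hc, map_add, map_sub, map_smul, smul_eq_mul, LinearMap.smul_apply,
        LinearMap.zero_apply, LinearMap.add_apply, LinearMap.sub_apply] <;> module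
end

section
/- Let B be a nondegenerate commutative 2-cocycle on a finite-dimensional Lie algebra (g,[−,−]) over a field of characteristic 0. Then there exists a (unique) bilinear operation ∘ on g determined by B(x∘y, z) = B(y, [x,z]) for all x,y,z ∈ g, and (g,∘) is an anti-pre-Lie algebra whose commutator recovers the Lie bracket: x∘y − y∘x = [x,y] for all x,y ∈ g. -/
/-- The cyclic sum of `B ⁅⁅x, y⁆, w⁆ z` over `x, y, z` vanishes for a commutative 2-cocycle `B`. -/
theorem cyclic_sum_lie_lie_eq_zero {F L : Type*} [Field F] [CharZero F]
    [LieRing L] [LieAlgebra F L] (B : L →ₗ[F] L →ₗ[F] F)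
    (hsymm : ∀ x y : L, B x y = B y x)
    (hcocycle : ∀ x y z : L, B ⁅x, y⁆ z + B ⁅y, z⁆ x + B ⁅z, x⁆ y = 0) (x y z w : L) :
    B ⁅⁅x, y⁆, w⁆ z + B ⁅⁅y, z⁆, w⁆ x + B ⁅⁅z, x⁆, w⁆ y = 0 := by
  have skew : ∀ a b c d : L, B ⁅⁅b, a⁆, c⁆ d = -B ⁅⁅a, b⁆, c⁆ d := fun a b c d => by
    rw [← lie_skew b a, neg_lie, map_neg, LinearMap.neg_apply]
  have jacobi : ∀ a b c d : L,
      B ⁅⁅a, b⁆, c⁆ d + B ⁅⁅b, c⁆, a⁆ d + B ⁅⁅c, a⁆, b⁆ d = 0 := fun a b c d => by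
    have h : ⁅⁅a, b⁆, c⁆ + ⁅⁅b, c⁆, a⁆ + ⁅⁅c, a⁆, b⁆ = 0 := by
      rw [← lie_skew ⁅a, b⁆ c, ← lie_skew ⁅b, c⁆ a, ← lie_skew ⁅c, a⁆ b, ← neg_add, ← neg_add,
        neg_eq_zero, add_assoc, add_comm, lie_jacobi]
    rw [← LinearMap.add_apply, ← LinearMap.add_apply, ← map_add, ← map_add, h, map_zero,
      LinearMap.zero_apply]
  have exchange : ∀ a b c d : L,
      B ⁅⁅a, b⁆, c⁆ d - B ⁅⁅a, b⁆, d⁆ c + B ⁅a, b⁆ ⁅c, d⁆ = 0 := fun a b c d => by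
    have h := hcocycle ⁅a, b⁆ c d
    rw [← lie_skew d, map_neg, LinearMap.neg_apply, hsymm ⁅c, d⁆] at h
    linear_combination h
  have qskew : ∀ a b c d : L, B ⁅a, b⁆ ⁅d, c⁆ = -B ⁅a, b⁆ ⁅c, d⁆ := fun a b c d => by
    rw [← lie_skew d c, map_neg]
  have e1 := exchange x y w z
  have e2 := exchange y z w x
  have e3 := exchange z x w y
  have e4 := exchange w z x y
  have e5 := exchange w x y z
  have e6 := exchange w y z x
  grind


/-- a nondegenerate commutative 2-cocycle on a finite-dimensional Lie
algebra induces a unique compatible anti-pre-Lie algebra structure via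
`B(x∘y, z) = B(y, [x,z])`. -/
theorem statement6 {F L : Type*} [Field F] [CharZero F]
    [LieRing L] [LieAlgebra F L] [FiniteDimensional F L]
    (B : L →ₗ[F] L →ₗ[F] F)
    (hsymm : ∀ x y : L, B x y = B y x)
    (hcocycle : ∀ x y z : L, B ⁅x, y⁆ z + B ⁅y, z⁆ x + B ⁅z, x⁆ y = 0)
    (hnondeg : ∀ x : L, (∀ y : L, B x y = 0) → x = 0) :
    ∃ c : L →ₗ[F] L →ₗ[F] L,
      (∀ x y z : L, B (c x y) z = B y ⁅x, z⁆) ∧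
      (∀ x y z : L, c x (c y z) - c y (c x z) = c (brkt c y x) z) ∧
      (∀ x y z : L, c (brkt c x y) z + c (brkt c y z) x + c (brkt c z x) y = 0) ∧
      (∀ x y : L, brkt c x y = ⁅x, y⁆) ∧
      (∀ c' : L →ₗ[F] L →ₗ[F] L, (∀ x y z : L, B (c' x y) z = B y ⁅x, z⁆) → c' = c) := by
  have hinj : Function.Injective B := by
    rw [← LinearMap.ker_eq_bot, LinearMap.ker_eq_bot']
    intro x hx
    exact hnondeg x fun y => by rw [hx, LinearMap.zero_apply]
  have hext : ∀ u v : L, (∀ w, B u w = B v w) → u = v :=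
    fun u v h => hinj (LinearMap.ext h)
  let e : L ≃ₗ[F] Module.Dual F L :=
    LinearMap.linearEquivOfInjective B hinj Subspace.dual_finrank_eq.symm
  have he : ∀ (φ : Module.Dual F L) (z : L), B (e.symm φ) z = φ z := fun φ z =>
    LinearMap.congr_fun (e.apply_symm_apply φ) z
  let c : L →ₗ[F] L →ₗ[F] L :=
    LinearMap.mk₂ F (fun x y => e.symm ((B y).comp (LieAlgebra.ad F L x : L →ₗ[F] L)))
      (fun x x' y => hext _ _ fun w => by simp [he])
      (fun a x y => hext _ _ fun w => by simp [he])
      (fun x y y' => hext _ _ fun w => by simp [he])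
      (fun a x y => hext _ _ fun w => by simp [he])
  have hc : ∀ x y z : L, B (c x y) z = B y ⁅x, z⁆ := fun x y z => by
    simp [c, he]
  have hbr : ∀ x y : L, brkt c x y = ⁅x, y⁆ := fun x y => hext _ _ fun w => by
    have h := hcocycle x y w
    rw [← lie_skew w x, map_neg, LinearMap.neg_apply] at h
    rw [brkt, map_sub, LinearMap.sub_apply, hc, hc, hsymm y, hsymm x]
    linear_combination -h
  refine ⟨c, hc, fun x y z => hext _ _ fun w => ?_, fun x y z => hext _ _ fun w => ?_, hbr,
    fun c' h' => LinearMap.ext fun x => LinearMap.ext fun y => hext _ _ fun w => ?_⟩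
  · rw [hbr, map_sub, LinearMap.sub_apply, hc, hc, hc, hc, hc, ← map_sub, lie_lie]
  · simp only [hbr, map_add, LinearMap.add_apply, hc, map_zero, LinearMap.zero_apply]
    rw [hsymm z, hsymm x, hsymm y]
    exact cyclic_sum_lie_lie_eq_zero B hsymm hcocycle x y z w
  · rw [h', hc]
end

section
/- Let (A,∘) be an anti-pre-Lie algebra over a field of characteristic 0 and let B be a symmetric bilinear form on A that is invariant, i.e. B(x∘y, z) = B(y, [x,z]) for all x,y,z ∈ A, where [x,y] = x∘y − y∘x. Then B is a commutative 2-cocycle on the sub-adjacent Lie algebra (A,[−,−]), i.e. B([x,y],z) + B([y,z],x) + B([z,x],y) = 0 for all x,y,z ∈ A. -/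
/-- a symmetric invariant bilinear form on an anti-pre-Lie algebra is a
commutative 2-cocycle on the sub-adjacent Lie algebra. -/
theorem statement7 {F A : Type*} [Field F] [CharZero F]
    [AddCommGroup A] [Module F A] (c : A →ₗ[F] A →ₗ[F] A)
    (h1 : ∀ x y z : A, c x (c y z) - c y (c x z) = c (brkt c y x) z)
    (h2 : ∀ x y z : A, c (brkt c x y) z + c (brkt c y z) x + c (brkt c z x) y = 0)
    (B : A →ₗ[F] A →ₗ[F] F)
    (hsymm : ∀ x y : A, B x y = B y x)
    (hinv : ∀ x y z : A, B (c x y) z = B y (brkt c x z)) :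
    ∀ x y z : A, B (brkt c x y) z + B (brkt c y z) x + B (brkt c z x) y = 0 := by
  intro x y z
  simp only [brkt, map_sub, LinearMap.sub_apply] at hinv ⊢
  have inv : ∀ u v w : A, B (c u v) w = B (c u w) v - B (c w u) v := fun u v w => by
    rw [hinv u v w, hsymm v, hsymm v]
  linear_combination inv x y z + inv z x y + inv z y x - inv x z y - inv y z x - inv y x z
end

section
/- Let B be a symmetric bilinear form on a vector space A over a field of characteristic 0 and let s ∈ A be a fixed vector. Define a bilinear operation ∘ on A by x∘y = B(x,y)s − B(x,s)y for all x,y ∈ A. Then (A,∘) is an anti-pre-Lie algebra, and B is invariant on (A,∘), i.e. B(x∘y,z) = B(y,[x,z]) for all x,y,z ∈ A, where [x,y] = x∘y − y∘x; consequently B is a commutative 2-cocycle on the sub-adjacent Lie algebra (A,[−,−]). -/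
/-- For `x∘y = B(x,y)s − B(x,s)y` with `B` symmetric, `[x,y] = B(y,s)x − B(x,s)y`. -/
theorem brkt_eq_smul_sub_smul {F A : Type*} [Field F] [AddCommGroup A] [Module F A]
    (B : A →ₗ[F] A →ₗ[F] F) (hsymm : ∀ x y : A, B x y = B y x) (s : A)
    (c : A →ₗ[F] A →ₗ[F] A)
    (hc : ∀ x y : A, c x y = B x y • s - B x s • y) (x y : A) :
    brkt c x y = B y s • x - B x s • y := by
  rw [brkt, hc, hc, hsymm y x]
  abel

/-- `x∘y = B(x,y)s − B(x,s)y` defines an anti-pre-Lie algebra on which `B`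
is invariant, hence `B` is a commutative 2-cocycle on the sub-adjacent Lie algebra. -/
theorem statement8 {F A : Type*} [Field F] [CharZero F]
    [AddCommGroup A] [Module F A]
    (B : A →ₗ[F] A →ₗ[F] F) (hsymm : ∀ x y : A, B x y = B y x) (s : A)
    (c : A →ₗ[F] A →ₗ[F] A)
    (hc : ∀ x y : A, c x y = B x y • s - B x s • y) :
    -- (A,∘) is an anti-pre-Lie algebra
    (∀ x y z : A, c x (c y z) - c y (c x z) = c (brkt c y x) z) ∧
    (∀ x y z : A, c (brkt c x y) z + c (brkt c y z) x + c (brkt c z x) y = 0) ∧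
    -- B is invariant on (A,∘)
    (∀ x y z : A, B (c x y) z = B y (brkt c x z)) ∧
    -- B is a commutative 2-cocycle on the sub-adjacent Lie algebra
    (∀ x y z : A, B (brkt c x y) z + B (brkt c y z) x + B (brkt c z x) y = 0) := by
  have hb := brkt_eq_smul_sub_smul B hsymm s c hc
  refine ⟨fun x y z => ?_, fun x y z => ?_, fun x y z => ?_, fun x y z => ?_⟩
  · simp only [hb, hc, map_sub, map_smul, LinearMap.sub_apply, LinearMap.smul_apply, smul_eq_mul]
    module
  · simp only [hb, hc, map_sub, map_smul, LinearMap.sub_apply, LinearMap.smul_apply,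
      hsymm y x, hsymm z x, hsymm z y]
    module
  · simp only [hb, hc, map_sub, map_smul, LinearMap.sub_apply, LinearMap.smul_apply, smul_eq_mul,
      hsymm y x, hsymm s z]
    ring
  · simp only [hb, map_sub, map_smul, LinearMap.sub_apply, LinearMap.smul_apply, smul_eq_mul,
      hsymm y x, hsymm z x, hsymm z y]
    ring
end

section
/- Every admissible Novikov algebra is an anti-pre-Lie algebra. That is, if A is a vector space over a field of characteristic 0 with a bilinear operation ∘ satisfying x∘(y∘z) − y∘(x∘z) = [y,x]∘z and 2x∘[y,z] = (x∘y)∘z − (x∘z)∘y for all x,y,z ∈ A (where [x,y] = x∘y − y∘x), then also [x,y]∘z + [y,z]∘x + [z,x]∘y = 0 for all x,y,z ∈ A. -/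
/-- every admissible Novikov algebra is an anti-pre-Lie algebra. -/
theorem statement9 {F A : Type*} [Field F] [CharZero F]
    [AddCommGroup A] [Module F A] (c : A →ₗ[F] A →ₗ[F] A)
    (h1 : ∀ x y z : A, c x (c y z) - c y (c x z) = c (brkt c y x) z)
    (h2 : ∀ x y z : A, 2 • c x (brkt c y z) = c (c x y) z - c (c x z) y) :
    ∀ x y z : A, c (brkt c x y) z + c (brkt c y z) x + c (brkt c z x) y = 0 := by
  intro x y z
  have key : (3 : F) • (c (brkt c x y) z + c (brkt c y z) x + c (brkt c z x) y) = 0 := by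
    have n1 := h1 x y z
    have n2 := h1 y z x
    have n3 := h1 z x y
    have m1 := h2 x y z
    have m2 := h2 y z x
    have m3 := h2 z x y
    simp only [brkt, map_sub, LinearMap.sub_apply] at n1 n2 n3 m1 m2 m3 ⊢
    linear_combination (norm := module) (2 : F) • (n1 + n2 + n3) - m1 - m2 - m3
  exact (smul_eq_zero.mp key).resolve_left three_ne_zero
end

section
/- Let (A,⋆) be a pre-Lie algebra over a field of characteristic 0 and let ∘ be its 2-algebra, i.e. x∘y = x⋆y + 2y⋆x for all x,y ∈ A. Then (A,∘) is an anti-pre-Lie algebra if and only if (A,⋆) is a Novikov algebra; moreover, in this case (A,∘) is an admissible Novikov algebra. -/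
/-- for a pre-Lie algebra `(A,⋆)` and its 2-algebra
`x∘y = x⋆y + 2y⋆x`, `(A,∘)` is anti-pre-Lie iff `(A,⋆)` is Novikov; moreover in that
case `(A,∘)` is an admissible Novikov algebra. -/
theorem statement10 {F A : Type*} [Field F] [CharZero F]
    [AddCommGroup A] [Module F A]
    (s : A →ₗ[F] A →ₗ[F] A)
    (hpre : ∀ x y z : A, s (s x y) z - s x (s y z) = s (s y x) z - s y (s x z))
    (c : A →ₗ[F] A →ₗ[F] A)
    (hc : ∀ x y : A, c x y = s x y + 2 • s y x) :
    (((∀ x y z : A, c x (c y z) - c y (c x z) = c (brkt c y x) z) ∧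
        (∀ x y z : A, c (brkt c x y) z + c (brkt c y z) x + c (brkt c z x) y = 0))
      ↔ (∀ x y z : A, s (s x y) z = s (s x z) y)) ∧
    ((∀ x y z : A, s (s x y) z = s (s x z) y) →
      ((∀ x y z : A, c x (c y z) - c y (c x z) = c (brkt c y x) z) ∧
        (∀ x y z : A, 2 • c x (brkt c y z) = c (c x y) z - c (c x z) y))) := by
  have lie_compat (h : ∀ x y z : A, s (s x y) z = s (s x z) y) (x y z : A) :
      c x (c y z) - c y (c x z) = c (brkt c y x) z := by
    simp only [brkt, hc, map_add, map_sub, map_nsmul, LinearMap.add_apply, LinearMap.sub_apply,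
      LinearMap.smul_apply]
    linear_combination (norm := module) (-1 : F) • hpre x y z + (-2 : F) • hpre x z y +
      (2 : F) • hpre y z x + (-6 : F) • h z x y
  refine ⟨⟨fun ⟨h, _⟩ x y z => ?_, fun h => ⟨lie_compat h, fun x y z => ?_⟩⟩,
    fun h => ⟨lie_compat h, fun x y z => ?_⟩⟩
  · have hyzx := h y z x
    simp only [brkt, hc, map_add, map_sub, map_nsmul, LinearMap.add_apply, LinearMap.sub_apply,
      LinearMap.smul_apply] at hyzx
    linear_combination (norm := module) (1/3 : F) • hpre x y z + (-1/3 : F) • hpre x z y +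
      (-1/6 : F) • hpre y z x + (-1/6 : F) • hyzx
  · simp only [brkt, hc, map_add, map_sub, map_nsmul, LinearMap.add_apply, LinearMap.sub_apply,
      LinearMap.smul_apply]
    linear_combination (norm := module) (2 : F) • hpre x y z + (-2 : F) • hpre x z y +
      (2 : F) • hpre y z x + (-3 : F) • h x y z + (3 : F) • h y x z + (-3 : F) • h z x y
  · simp only [brkt, hc, map_add, map_sub, map_nsmul, LinearMap.add_apply, LinearMap.sub_apply,
      LinearMap.smul_apply]
    linear_combination (norm := module) (2 : F) • hpre x y z + (-2 : F) • hpre x z y +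
      (-4 : F) • hpre y z x + (-3 : F) • h x y z
end

section
/- Let (A,∘) be an anti-pre-Lie algebra over a field of characteristic 0 and let ⋆ be its (−2)-algebra, i.e. x⋆y = x∘y − 2y∘x for all x,y ∈ A. Then (A,⋆) is a pre-Lie algebra if and only if (A,∘) is an admissible Novikov algebra; moreover, in this case (A,⋆) is a Novikov algebra. -/
/-- for an anti-pre-Lie algebra `(A,∘)` and its (−2)-algebra
`x⋆y = x∘y − 2y∘x`, `(A,⋆)` is pre-Lie iff `(A,∘)` is an admissible Novikov algebra;
moreover in that case `(A,⋆)` is a Novikov algebra. -/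
theorem statement11 {F A : Type*} [Field F] [CharZero F]
    [AddCommGroup A] [Module F A]
    (c : A →ₗ[F] A →ₗ[F] A)
    (h1 : ∀ x y z : A, c x (c y z) - c y (c x z) = c (brkt c y x) z)
    (h2 : ∀ x y z : A, c (brkt c x y) z + c (brkt c y z) x + c (brkt c z x) y = 0)
    (s : A →ₗ[F] A →ₗ[F] A)
    (hs : ∀ x y : A, s x y = c x y - 2 • c y x) :
    ((∀ x y z : A, s (s x y) z - s x (s y z) = s (s y x) z - s y (s x z))
      ↔ ((∀ x y z : A, c x (c y z) - c y (c x z) = c (brkt c y x) z) ∧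
          (∀ x y z : A, 2 • c x (brkt c y z) = c (c x y) z - c (c x z) y))) ∧
    (((∀ x y z : A, c x (c y z) - c y (c x z) = c (brkt c y x) z) ∧
        (∀ x y z : A, 2 • c x (brkt c y z) = c (c x y) z - c (c x z) y)) →
      ((∀ x y z : A, s (s x y) z - s x (s y z) = s (s y x) z - s y (s x z)) ∧
        (∀ x y z : A, s (s x y) z = s (s x z) y))) := by
  have prelie : (∀ x y z : A, 2 • c x (brkt c y z) = c (c x y) z - c (c x z) y) →
      ∀ x y z : A, s (s x y) z - s x (s y z) = s (s y x) z - s y (s x z) := by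
    intro hN x y z
    have a₁ := h1 x y z
    have a₂ := h1 y z x
    have a₃ := h1 z x y
    have n₁ := hN x y z
    have n₂ := hN y z x
    have n₃ := hN z x y
    simp only [hs, brkt, map_sub, map_nsmul, LinearMap.sub_apply, LinearMap.smul_apply]
      at a₁ a₂ a₃ n₁ n₂ n₃ ⊢
    linear_combination (norm := module) (5 / 3 : F) • a₁ + (2 / 3 : F) • a₂ + (2 / 3 : F) • a₃
      - (4 / 3 : F) • n₁ - (4 / 3 : F) • n₂ - (10 / 3 : F) • n₃
  refine ⟨⟨fun hE => ⟨h1, fun x y z => ?_⟩, fun h => prelie h.2⟩,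
    fun h => ⟨prelie h.2, fun x y z => ?_⟩⟩
  · have a := h1 y z x
    have e₁ := hE x y z
    have e₂ := hE y z x
    have e₃ := hE z x y
    simp only [hs, brkt, map_sub, map_nsmul, LinearMap.sub_apply, LinearMap.smul_apply]
      at a e₁ e₂ e₃ ⊢
    linear_combination (norm := module) (1 / 2 : F) • a + (1 / 9 : F) • e₁ - (7 / 18 : F) • e₂
      + (1 / 9 : F) • e₃
  · have a₁ := h1 x y z
    have a₂ := h1 y z x
    have a₃ := h1 z x y
    have n₁ := h.2 x y z
    have n₂ := h.2 y z x
    have n₃ := h.2 z x y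
    simp only [hs, brkt, map_sub, map_nsmul, LinearMap.sub_apply, LinearMap.smul_apply]
      at a₁ a₂ a₃ n₁ n₂ n₃ ⊢
    linear_combination (norm := module) (2 / 3 : F) • a₁ - (4 / 3 : F) • a₂ + (2 / 3 : F) • a₃
      - (1 / 3 : F) • n₁ - (4 / 3 : F) • n₂ - (4 / 3 : F) • n₃
end

section
/- Let B be a symmetric bilinear form on a Novikov algebra (A,⋆) over a field of characteristic 0, and let (A,∘) be the corresponding admissible Novikov algebra, i.e. x∘y = x⋆y + 2y⋆x. Then B is invariant on (A,∘) (i.e. B(x∘y,z) = B(y,[x,z]) for all x,y,z, where [x,y] = x∘y − y∘x) if and only if B(x⋆y, z) = −B(y, x⋆z + z⋆x) for all x,y,z ∈ A. -/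
/-- a symmetric bilinear form `B` on a Novikov algebra `(A,⋆)` is
invariant on the corresponding admissible Novikov algebra `(A,∘)` (the 2-algebra,
`x∘y = x⋆y + 2y⋆x`) iff `B(x⋆y,z) = −B(y, x⋆z + z⋆x)` for all `x,y,z`. -/
theorem statement12 {F A : Type*} [Field F] [CharZero F]
    [AddCommGroup A] [Module F A]
    (s : A →ₗ[F] A →ₗ[F] A)
    (hpre : ∀ x y z : A, s (s x y) z - s x (s y z) = s (s y x) z - s y (s x z))
    (hNov : ∀ x y z : A, s (s x y) z = s (s x z) y)
    (B : A →ₗ[F] A →ₗ[F] F)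
    (hsymm : ∀ x y : A, B x y = B y x)
    (c : A →ₗ[F] A →ₗ[F] A)
    (hc : ∀ x y : A, c x y = s x y + 2 • s y x) :
    (∀ x y z : A, B (c x y) z = B y (brkt c x z))
      ↔ (∀ x y z : A, B (s x y) z = - B y (s x z + s z x)) := by
  simp only [brkt, hc, map_add, map_sub, map_nsmul, LinearMap.add_apply, LinearMap.smul_apply,
    nsmul_eq_mul, Nat.cast_ofNat]
  constructor
  · intro h x y z
    have h₁ := h x y z
    have h₂ := h x z y
    simp only [hsymm y, hsymm z] at h₁ h₂ ⊢
    have h₃ : (3 : F) * B (s y x) z = 3 * B (s z x) y := by linear_combination h₁ - h₂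
    have h₄ := mul_left_cancel₀ (three_ne_zero : (3 : F) ≠ 0) h₃
    linear_combination h₁ - 2 * h₄
  · intro h x y z
    have h₁ := h x y z
    have h₂ := h x z y
    simp only [hsymm y, hsymm z] at h₁ h₂ ⊢
    linear_combination 2 * h₂ - h₁
end

section
/- Let (P,Q) be an admissible pair on a commutative associative algebra (A,·) over a field of characteristic 0, i.e. Q(x·y) = Q(x)·y + x·P(y) for all x,y ∈ A. Define [x,y] = Q(x)·y − x·Q(y). Then (A,[−,−]) is a Lie algebra. Moreover, if B is a symmetric bilinear form on A that is invariant on (A,·), i.e. B(x·y,z) = B(x,y·z) for all x,y,z ∈ A, then B is a commutative 2-cocycle on (A,[−,−]), i.e. B([x,y],z) + B([y,z],x) + B([z,x],y) = 0 for all x,y,z ∈ A. -/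
/-- The bracket `[x,y] = Q(x)·y − x·Q(y)` induced by a linear map `Q` on a
(non-unital) commutative associative algebra. -/
def brQ {F A : Type*} [Field F] [NonUnitalCommRing A] [Module F A]
    (Q : A →ₗ[F] A) (x y : A) : A := Q x * y - x * Q y

/-- for an admissible pair `(P,Q)` on a commutative associative algebra,
`[x,y] = Q(x)·y − x·Q(y)` defines a Lie algebra, and any symmetric invariant bilinear
form on `(A,·)` is a commutative 2-cocycle on this Lie algebra. -/
theorem statement14 {F A : Type*} [Field F] [CharZero F]
    [NonUnitalCommRing A] [Module F A] [SMulCommClass F A A] [IsScalarTower F A A]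
    (P Q : A →ₗ[F] A)
    (hPQ : ∀ x y : A, Q (x * y) = Q x * y + x * P y)
    (B : A →ₗ[F] A →ₗ[F] F)
    (hsymm : ∀ x y : A, B x y = B y x)
    (hinv : ∀ x y z : A, B (x * y) z = B x (y * z)) :
    -- (A,[−,−]) is a Lie algebra
    (∀ x y : A, brQ Q x y = - brQ Q y x) ∧
    (∀ x y z : A, brQ Q (brQ Q x y) z + brQ Q (brQ Q y z) x + brQ Q (brQ Q z x) y = 0) ∧
    -- B is a commutative 2-cocycle on (A,[−,−])
    (∀ x y z : A, B (brQ Q x y) z + B (brQ Q y z) x + B (brQ Q z x) y = 0) := by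
  have hbr : ∀ x y : A, Q (brQ Q x y) = y * P (Q x) - x * P (Q y) := fun x y => by
    rw [brQ, map_sub, mul_comm (Q x) y, hPQ, hPQ, mul_comm (Q y) (Q x)]
    abel
  have hB : ∀ x y z : A, B (brQ Q x y) z = B (Q x) (y * z) - B (Q y) (x * z) := fun x y z => by
    rw [brQ, map_sub, LinearMap.sub_apply, hinv, mul_comm x, hinv]
  refine ⟨fun x y => ?_, fun x y z => ?_, fun x y z => ?_⟩
  · rw [brQ, brQ, neg_sub, mul_comm x, mul_comm (Q x)]
  · rw [brQ.eq_1 Q (brQ Q x y), brQ.eq_1 Q (brQ Q y z), brQ.eq_1 Q (brQ Q z x), hbr, hbr, hbr]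
    simp only [brQ, mul_sub, mul_comm, mul_left_comm]
    abel
  · rw [hB, hB, hB, mul_comm z x, mul_comm z y, mul_comm y x]
    ring
end

section
/- Let (P,Q) be an admissible pair on a commutative associative algebra (A,·) over a field of characteristic 0, i.e. Q(x·y) = Q(x)·y + x·P(y) for all x,y ∈ A. Define a bilinear operation ⋆ on A by x⋆y = x·Q(y). Then (A,⋆) is a Novikov algebra. -/
/-- for an admissible pair `(P,Q)` on a commutative associative algebra,
`x⋆y = x·Q(y)` defines a Novikov algebra. -/
theorem statement15 {F A : Type*} [Field F] [CharZero F]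
    [NonUnitalCommRing A] [Module F A] [SMulCommClass F A A] [IsScalarTower F A A]
    (P Q : A →ₗ[F] A)
    (hPQ : ∀ x y : A, Q (x * y) = Q x * y + x * P y)
    (s : A →ₗ[F] A →ₗ[F] A)
    (hs : ∀ x y : A, s x y = x * Q y) :
    -- (A,⋆) is a pre-Lie algebra
    (∀ x y z : A, s (s x y) z - s x (s y z) = s (s y x) z - s y (s x z)) ∧
    -- satisfying the Novikov identity
    (∀ x y z : A, s (s x y) z = s (s x z) y) := by
  constructor
  · -- both associators equal `-(x * y * P (Q z))`
    intro x y z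
    simp only [hs, hPQ, mul_add, mul_assoc, sub_add_cancel_left]
    rw [mul_left_comm x y]
  · intro x y z
    simp only [hs]
    exact mul_right_comm x (Q y) (Q z)
end

section
/- Let (P,Q) be an admissible pair on a commutative associative algebra (A,·) over a field of characteristic 0, i.e. Q(x·y) = Q(x)·y + x·P(y) for all x,y ∈ A. Define a bilinear operation ∘ on A by x∘y = x·Q(y) + 2Q(x)·y. Then (A,∘) is an admissible Novikov algebra, and its commutator satisfies x∘y − y∘x = Q(x)·y − x·Q(y) for all x,y ∈ A. -/
/-- for an admissible pair `(P,Q)` on a commutative associative algebra,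
`x∘y = x·Q(y) + 2Q(x)·y` defines an admissible Novikov algebra whose commutator is
`x∘y − y∘x = Q(x)·y − x·Q(y)`. -/
theorem statement16 {F A : Type*} [Field F] [CharZero F]
    [NonUnitalCommRing A] [Module F A] [SMulCommClass F A A] [IsScalarTower F A A]
    (P Q : A →ₗ[F] A)
    (hPQ : ∀ x y : A, Q (x * y) = Q x * y + x * P y)
    (c : A →ₗ[F] A →ₗ[F] A)
    (hc : ∀ x y : A, c x y = x * Q y + 2 • (Q x * y)) :
    -- (A,∘) is an admissible Novikov algebra
    (∀ x y z : A, c x (c y z) - c y (c x z) = c (brkt c y x) z) ∧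
    (∀ x y z : A, 2 • c x (brkt c y z) = c (c x y) z - c (c x z) y) ∧
    -- whose commutator satisfies
    (∀ x y : A, brkt c x y = Q x * y - x * Q y) := by
  have hQ (x y : A) : Q (x * Q y) = Q x * Q y + x * P (Q y) := hPQ x (Q y)
  have hQ' (x y : A) : Q (Q x * y) = Q x * Q y + y * P (Q x) := by
    rw [mul_comm, hPQ, mul_comm (Q y)]
  refine ⟨fun x y z => ?_, fun x y z => ?_, fun x y => ?_⟩
  all_goals
    simp only [brkt, hc, map_add, map_sub, LinearMap.add_apply, LinearMap.sub_apply, hQ, hQ',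
      two_smul]
    simp only [mul_add, mul_sub, mul_comm, mul_left_comm]
    abel
end

section
/- Let (A,·) be a commutative associative algebra over a field of characteristic 0 and let ∘ be a bilinear operation on A. Let ⋆ be the (−2)-algebra of ∘, i.e. x⋆y = x∘y − 2y∘x. Then the two identities 2(x∘y)·z − 2(y∘x)·z = y·(x∘z) − x·(y∘z) and 2x∘(y·z) = (z·x)∘y + z·(x∘y) hold for all x,y,z ∈ A if and only if the two identities (x·y)⋆z = x·(y⋆z) and (x⋆y)·z − (y⋆x)·z = x⋆(y·z) − y⋆(x·z) hold for all x,y,z ∈ A. In particular, (A,·,∘) is an admissible Novikov-Poisson algebra if and only if (A,·,⋆) is a Novikov-Poisson algebra. -/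
/-- The compatibility identities of an operation with a commutative associative product, in terms of
its (−2)-algebra. -/
theorem poisson_compatibility_iff
    {F A : Type*} [Field F] [CharZero F]
    [NonUnitalCommRing A] [Module F A] [SMulCommClass F A A] [IsScalarTower F A A]
    {c s : A →ₗ[F] A →ₗ[F] A} (hs : ∀ x y : A, s x y = c x y - 2 • c y x) :
    ((∀ x y z : A, 2 • (c x y * z) - 2 • (c y x * z) = y * c x z - x * c y z) ∧
      (∀ x y z : A, 2 • c x (y * z) = c (z * x) y + z * c x y)) ↔
    ((∀ x y z : A, s (x * y) z = x * s y z) ∧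
      (∀ x y z : A, s x y * z - s y x * z = s x (y * z) - s y (x * z))) := by
  constructor <;> rintro ⟨h₁, h₂⟩ <;> refine ⟨fun x y z => ?_, fun x y z => ?_⟩
  · linear_combination (norm := skip)
      (-1 : F) • h₁ y z x + (1 : F) • h₂ y x z + (-1 : F) • h₂ y z x +
      (-1 : F) • h₂ z x y
    simp only [hs, mul_sub, mul_smul_comm, mul_comm]
    module
  · linear_combination (norm := skip)
      (5/2 : F) • h₁ x y z + (2 : F) • h₂ x y z + (-5/2 : F) • h₂ x z y +
      (-2 : F) • h₂ y x z + (5/2 : F) • h₂ y z x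
    simp only [hs, mul_sub, mul_smul_comm, mul_comm]
    module
  · linear_combination (norm := skip)
      (1 : F) • h₁ x y z + (-1 : F) • h₁ y x z + (2/3 : F) • h₂ x y z +
      (-2/3 : F) • h₂ x z y + (2/3 : F) • h₂ y z x
    simp only [hs, mul_sub, mul_smul_comm, mul_comm]
    module
  · linear_combination (norm := skip)
      (1/3 : F) • h₁ z x y + (-4/3 : F) • h₁ z y x + (2/3 : F) • h₂ x y z
    simp only [hs, mul_sub, mul_smul_comm, mul_comm]
    module

/-- An operation is admissible Novikov iff its (−2)-algebra is Novikov. -/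
theorem admissible_novikov_iff
    {F A : Type*} [Field F] [CharZero F]
    [AddCommGroup A] [Module F A]
    {c s : A →ₗ[F] A →ₗ[F] A} (hs : ∀ x y : A, s x y = c x y - 2 • c y x) :
    ((∀ x y z : A, c x (c y z) - c y (c x z) = c (brkt c y x) z) ∧
      (∀ x y z : A, 2 • c x (brkt c y z) = c (c x y) z - c (c x z) y)) ↔
    ((∀ x y z : A, s (s x y) z - s x (s y z) = s (s y x) z - s y (s x z)) ∧
      (∀ x y z : A, s (s x y) z = s (s x z) y)) := by
  constructor <;> rintro ⟨h₁, h₂⟩ <;> refine ⟨fun x y z => ?_, fun x y z => ?_⟩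
  · linear_combination (norm := skip)
      (5/3 : F) • h₁ x y z + (-2/3 : F) • h₁ x z y + (2/3 : F) • h₁ y z x +
      (-4/3 : F) • h₂ x y z + (4/3 : F) • h₂ y x z + (-10/3 : F) • h₂ z x y
    simp only [hs, brkt, map_sub, map_nsmul, LinearMap.sub_apply, LinearMap.smul_apply]
    module
  · linear_combination (norm := skip)
      (2/3 : F) • h₁ x y z + (-2/3 : F) • h₁ x z y + (-4/3 : F) • h₁ y z x +
      (-1/3 : F) • h₂ x y z + (4/3 : F) • h₂ y x z + (-4/3 : F) • h₂ z x y
    simp only [hs, brkt, map_sub, map_nsmul, LinearMap.sub_apply, LinearMap.smul_apply]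
    module
  · linear_combination (norm := skip)
      (-1/9 : F) • h₁ x y z + (-2/9 : F) • h₁ x z y + (2/9 : F) • h₁ y z x +
      (-2/3 : F) • h₂ z x y
    simp only [hs, brkt, map_sub, map_nsmul, LinearMap.sub_apply, LinearMap.smul_apply]
    module
  · linear_combination (norm := skip)
      (2/9 : F) • h₁ x y z + (-2/9 : F) • h₁ x z y + (-4/9 : F) • h₁ y z x +
      (-1/3 : F) • h₂ x y z
    simp only [hs, brkt, map_sub, map_nsmul, LinearMap.sub_apply, LinearMap.smul_apply]
    module

/-- for a commutative associative algebra `(A,·)`, a bilinear operation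
`∘` and its (−2)-algebra `x⋆y = x∘y − 2y∘x`, the anti-pre-Lie-Poisson compatibility
identities for `(·,∘)` hold iff the Novikov-Poisson compatibility identities for
`(·,⋆)` hold; in particular `(A,·,∘)` is an admissible Novikov-Poisson algebra iff
`(A,·,⋆)` is a Novikov-Poisson algebra. -/
theorem statement17 {F A : Type*} [Field F] [CharZero F]
    [NonUnitalCommRing A] [Module F A] [SMulCommClass F A A] [IsScalarTower F A A]
    (c : A →ₗ[F] A →ₗ[F] A)
    (s : A →ₗ[F] A →ₗ[F] A)
    (hs : ∀ x y : A, s x y = c x y - 2 • c y x) :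
    -- equivalence of the compatibility identities
    (((∀ x y z : A, 2 • (c x y * z) - 2 • (c y x * z) = y * c x z - x * c y z) ∧
        (∀ x y z : A, 2 • c x (y * z) = c (z * x) y + z * c x y))
      ↔ ((∀ x y z : A, s (x * y) z = x * s y z) ∧
          (∀ x y z : A, s x y * z - s y x * z = s x (y * z) - s y (x * z)))) ∧
    -- in particular: admissible Novikov-Poisson iff Novikov-Poisson
    ((((∀ x y z : A, c x (c y z) - c y (c x z) = c (brkt c y x) z) ∧
        (∀ x y z : A, 2 • c x (brkt c y z) = c (c x y) z - c (c x z) y)) ∧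
      (∀ x y z : A, 2 • (c x y * z) - 2 • (c y x * z) = y * c x z - x * c y z) ∧
      (∀ x y z : A, 2 • c x (y * z) = c (z * x) y + z * c x y))
      ↔ (((∀ x y z : A, s (s x y) z - s x (s y z) = s (s y x) z - s y (s x z)) ∧
          (∀ x y z : A, s (s x y) z = s (s x z) y)) ∧
        (∀ x y z : A, s (x * y) z = x * s y z) ∧
        (∀ x y z : A, s x y * z - s y x * z = s x (y * z) - s y (x * z)))) := by
  exact ⟨poisson_compatibility_iff hs,
    and_congr (admissible_novikov_iff hs) (poisson_compatibility_iff hs)⟩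
end

section
/- Let (A,·) be a commutative associative algebra over a field of characteristic 0 and let ∘ be a bilinear operation on A that is Lie-admissible (i.e. the commutator [x,y] = x∘y − y∘x satisfies the Jacobi identity) and satisfies 2(x∘y)·z − 2(y∘x)·z = y·(x∘z) − x·(y∘z) and 2x∘(y·z) = (z·x)∘y + z·(x∘y) for all x,y,z ∈ A. Then (A,·,[−,−]) is a transposed Poisson algebra, i.e. 2z·[x,y] = [z·x, y] + [x, z·y] for all x,y,z ∈ A. In particular, if (A,·,∘) is an anti-pre-Lie Poisson algebra, then (A,·,[−,−]) is a transposed Poisson algebra. -/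
/-- if `(A,·)` is commutative associative and `∘` is a Lie-admissible
bilinear operation satisfying the two anti-pre-Lie-Poisson compatibility identities,
then `(A,·,[−,−])` is a transposed Poisson algebra (where `[x,y] = x∘y − y∘x`). -/
theorem statement18 {F A : Type*} [Field F] [CharZero F]
    [NonUnitalCommRing A] [Module F A] [SMulCommClass F A A] [IsScalarTower F A A]
    (c : A →ₗ[F] A →ₗ[F] A)
    (hLieAdm : ∀ x y z : A,
      brkt c (brkt c x y) z + brkt c (brkt c y z) x + brkt c (brkt c z x) y = 0)
    (hp1 : ∀ x y z : A, 2 • (c x y * z) - 2 • (c y x * z) = y * c x z - x * c y z)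
    (hp2 : ∀ x y z : A, 2 • c x (y * z) = c (z * x) y + z * c x y) :
    ∀ x y z : A, 2 • (z * brkt c x y) = brkt c (z * x) y + brkt c x (z * y) := by
  intro x y z
  simp only [brkt, mul_sub]
  have hxyz := hp1 x y z
  have hyzx := hp1 y z x
  have hzxy := hp1 z x y
  have hx := hp2 x y z
  have hy := hp2 y x z
  have hz := hp2 z x y
  have hz' := hp2 z y x
  rw [mul_comm (c x y), mul_comm (c y x)] at hxyz
  rw [mul_comm (c y z), mul_comm (c z y)] at hyzx
  rw [mul_comm (c z x), mul_comm (c x z)] at hzxy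
  rw [mul_comm y z] at hx hz
  rw [mul_comm x z] at hy hz'
  rw [mul_comm y x] at hz'
  linear_combination (norm := module) (1 : F) • hxyz - (1 / 2 : F) • hyzx - (1 / 2 : F) • hzxy
    - (1 / 2 : F) • hx + (1 / 2 : F) • hy - (3 / 2 : F) • hz + (3 / 2 : F) • hz'
end

section
/- Let (A₁,·₁,∘₁) and (A₂,·₂,∘₂) be two anti-pre-Lie Poisson algebras over a field of characteristic 0. On the tensor product A₁ ⊗ A₂ define bilinear operations by (x₁⊗x₂)·(y₁⊗y₂) = (x₁·₁y₁) ⊗ (x₂·₂y₂) and (x₁⊗x₂)∘(y₁⊗y₂) = (x₁∘₁y₁) ⊗ (x₂·₂y₂) + (x₁·₁y₁) ⊗ (x₂∘₂y₂), extended bilinearly. Then (A₁ ⊗ A₂, ·, ∘) is an anti-pre-Lie Poisson algebra. -/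
open TensorProduct

/-- The laws of an anti-pre-Lie Poisson algebra, for the product `m` and the operation `c`. -/
structure IsAntiPreLiePoisson {F A : Type*} [Field F] [AddCommGroup A] [Module F A]
    (m c : A →ₗ[F] A →ₗ[F] A) : Prop where
  comm : ∀ x y : A, m x y = m y x
  assoc : ∀ x y z : A, m (m x y) z = m x (m y z)
  lie_admissible : ∀ x y z : A, c x (c y z) - c y (c x z) = c (brkt c y x) z
  cyclic : ∀ x y z : A, c (brkt c x y) z + c (brkt c y z) x + c (brkt c z x) y = 0
  compat_comm : ∀ x y z : A,
    2 • m (c x y) z - 2 • m (c y x) z = m y (c x z) - m x (c y z)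
  compat_mul : ∀ x y z : A, 2 • c x (m y z) = c (m z x) y + m z (c x y)

namespace IsAntiPreLiePoisson

variable {F A : Type*} [Field F] [AddCommGroup A] [Module F A] {m c : A →ₗ[F] A →ₗ[F] A}

/-- Products of three elements, all rewritten to `m x (m y z)`. -/
theorem mul_mul_normal_form (h : IsAntiPreLiePoisson m c) (x y z : A) :
    m x (m z y) = m x (m y z) ∧ m y (m x z) = m x (m y z) ∧ m y (m z x) = m x (m y z) ∧
    m z (m x y) = m x (m y z) ∧ m z (m y x) = m x (m y z) := by
  have left_comm (a b d : A) : m a (m b d) = m b (m a d) := by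
    rw [← h.assoc, h.comm a b, h.assoc]
  refine ⟨by rw [h.comm z y], left_comm y x z, ?_, ?_, ?_⟩
  · rw [h.comm z x, left_comm y x z]
  · rw [left_comm z x y, h.comm z y]
  · rw [h.comm y x, left_comm z x y, h.comm z y]

/-- The monomials with one product and one operation `c` in three elements are spanned by
`c x (m y z)`, `m y (c x z)`, `m x (c z y)` and `m x (c y z)`. -/
theorem mul_op_normal_form [CharZero F] (h : IsAntiPreLiePoisson m c) (x y z : A) :
    c (m x y) z = (2 : F) • c x (m y z) - m y (c x z) ∧
    c (m x z) y = (2 : F) • c x (m y z) - m y (c x z) + m x (c z y) - m x (c y z) ∧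
    c (m y z) x = (2 : F) • c x (m y z) - (3 / 2 : F) • m y (c x z) + m x (c z y)
      - (1 / 2 : F) • m x (c y z) ∧
    c z (m x y) = c x (m y z) - (1 / 2 : F) • m y (c x z) + m x (c z y)
      - (1 / 2 : F) • m x (c y z) ∧
    c y (m x z) = c x (m y z) - (1 / 2 : F) • m y (c x z) + (1 / 2 : F) • m x (c y z) ∧
    m z (c y x) = (1 / 2 : F) • m y (c x z) - m x (c z y) + (3 / 2 : F) • m x (c y z) ∧
    m z (c x y) = m y (c x z) - m x (c z y) + m x (c y z) ∧
    m y (c z x) = (1 / 2 : F) • m y (c x z) + m x (c z y) - (1 / 2 : F) • m x (c y z) := by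
  have hp1 (a b d : A) :
      (2 : F) • m d (c a b) - (2 : F) • m d (c b a) = m b (c a d) - m a (c b d) := by
    have := h.compat_comm a b d
    rw [h.comm (c a b), h.comm (c b a)] at this
    simpa only [ofNat_smul_eq_nsmul] using this
  have hp2 (a b d : A) : (2 : F) • c a (m b d) = c (m d a) b + m d (c a b) := by
    simpa only [ofNat_smul_eq_nsmul] using h.compat_mul a b d
  have e1 := hp2 x y z
  have e2 := hp2 x z y
  have e3 := hp2 y x z
  have e4 := hp2 y z x
  have e5 := hp2 z x y
  have f1 := hp1 x z y
  have f2 := hp1 y x z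
  have f3 := hp1 y z x
  simp only [h.comm y x, h.comm z x, h.comm z y] at e1 e2 e3 e4 e5
  refine ⟨?_, ?_, ?_, ?_, ?_, ?_, ?_, ?_⟩
  · linear_combination (norm := module) (-1 : F) • e2
  · linear_combination (norm := module)
      (-1 : F) • e1 + (1 / 3 : F) • f1 + (1 / 3 : F) • f2 + (2 / 3 : F) • f3
  · linear_combination (norm := module) (1 / 3 : F) • f1 + (-1 : F) • e2 + (-1 / 6 : F) • f2
      + (-1 : F) • e3 + (2 / 3 : F) • f3 + (1 : F) • e4
  · linear_combination (norm := module) (-1 / 2 : F) • e2 + (-1 / 2 : F) • e3 + (1 / 2 : F) • f3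
      + (1 / 2 : F) • e4 + (1 / 2 : F) • e5
  · linear_combination (norm := module) (-1 / 2 : F) • e2 + (1 / 2 : F) • e4
  · linear_combination (norm := module) (-1 / 3 : F) • f1 + (1 / 6 : F) • f2 + (-2 / 3 : F) • f3
  · linear_combination (norm := module) (-1 / 3 : F) • f1 + (-1 / 3 : F) • f2 + (-2 / 3 : F) • f3
  · linear_combination (norm := module) (-1 / 3 : F) • f1 + (1 / 6 : F) • f2 + (1 / 3 : F) • f3

/-- Linear relations between the iterated operations `c` in three elements. -/
theorem op_op_normal_form (h : IsAntiPreLiePoisson m c) (x y z : A) :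
    c x (c y z) = c y (c x z) + c (c y x) z - c (c x y) z ∧
    c x (c z y) = c z (c x y) + c (c z x) y - c (c x z) y ∧
    c y (c z x) = c z (c y x) + c (c z y) x - c (c y z) x ∧
    c (c x y) z = c (c y x) z - c (c y z) x + c (c z y) x - c (c z x) y + c (c x z) y := by
  have h1 := h.lie_admissible x y z
  have h2 := h.lie_admissible x z y
  have h3 := h.lie_admissible y z x
  have h4 := h.cyclic x y z
  simp only [brkt, map_sub, LinearMap.sub_apply] at h1 h2 h3 h4
  refine ⟨?_, ?_, ?_, ?_⟩
  · linear_combination (norm := abel) h1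
  · linear_combination (norm := abel) h2
  · linear_combination (norm := abel) h3
  · linear_combination (norm := abel) h4

end IsAntiPreLiePoisson

/-- A triadditive function on a tensor product vanishes if it vanishes on pure tensors. -/
theorem TensorProduct.triadditive_eq_zero {F A B X : Type*} [Field F]
    [AddCommGroup A] [Module F A] [AddCommGroup B] [Module F B] [AddCommGroup X]
    (f : A ⊗[F] B → A ⊗[F] B → A ⊗[F] B → X)
    (add_left : ∀ a a' b d, f (a + a') b d = f a b d + f a' b d)
    (add_mid : ∀ a b b' d, f a (b + b') d = f a b d + f a b' d)
    (add_right : ∀ a b d d', f a b (d + d') = f a b d + f a b d')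
    (pure : ∀ x y z : A, ∀ x' y' z' : B, f (x ⊗ₜ x') (y ⊗ₜ y') (z ⊗ₜ z') = 0)
    (a b d : A ⊗[F] B) : f a b d = 0 := by
  induction a with
  | zero => simpa using add_left 0 0 b d
  | add a a' ha ha' => rw [add_left, ha, ha', add_zero]
  | tmul x x' =>
    induction b with
    | zero => simpa using add_mid (x ⊗ₜ x') 0 0 d
    | add b b' hb hb' => rw [add_mid, hb, hb', add_zero]
    | tmul y y' =>
      induction d with
      | zero => simpa using add_right (x ⊗ₜ x') (y ⊗ₜ y') 0 0
      | add d d' hd hd' => rw [add_right, hd, hd', add_zero]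
      | tmul z z' => exact pure x y z x' y' z'

set_option linter.unusedSimpArgs false in
/-- the tensor product of two anti-pre-Lie Poisson algebras, with the
operations `(x₁⊗x₂)·(y₁⊗y₂) = (x₁·₁y₁)⊗(x₂·₂y₂)` and
`(x₁⊗x₂)∘(y₁⊗y₂) = (x₁∘₁y₁)⊗(x₂·₂y₂) + (x₁·₁y₁)⊗(x₂∘₂y₂)` extended bilinearly,
is an anti-pre-Lie Poisson algebra. -/
theorem statement19 {F A₁ A₂ : Type*} [Field F] [CharZero F]
    [AddCommGroup A₁] [Module F A₁] [AddCommGroup A₂] [Module F A₂]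
    (m₁ c₁ : A₁ →ₗ[F] A₁ →ₗ[F] A₁) (m₂ c₂ : A₂ →ₗ[F] A₂ →ₗ[F] A₂)
    -- (A₁,·₁) is commutative associative
    (hm₁comm : ∀ x y : A₁, m₁ x y = m₁ y x)
    (hm₁assoc : ∀ x y z : A₁, m₁ (m₁ x y) z = m₁ x (m₁ y z))
    -- (A₁,∘₁) is anti-pre-Lie
    (h1₁ : ∀ x y z : A₁, c₁ x (c₁ y z) - c₁ y (c₁ x z) = c₁ (brkt c₁ y x) z)
    (h2₁ : ∀ x y z : A₁, c₁ (brkt c₁ x y) z + c₁ (brkt c₁ y z) x + c₁ (brkt c₁ z x) y = 0)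
    -- compatibility identities for (A₁,·₁,∘₁)
    (hp1₁ : ∀ x y z : A₁, 2 • m₁ (c₁ x y) z - 2 • m₁ (c₁ y x) z = m₁ y (c₁ x z) - m₁ x (c₁ y z))
    (hp2₁ : ∀ x y z : A₁, 2 • c₁ x (m₁ y z) = c₁ (m₁ z x) y + m₁ z (c₁ x y))
    -- (A₂,·₂) is commutative associative
    (hm₂comm : ∀ x y : A₂, m₂ x y = m₂ y x)
    (hm₂assoc : ∀ x y z : A₂, m₂ (m₂ x y) z = m₂ x (m₂ y z))
    -- (A₂,∘₂) is anti-pre-Lie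
    (h1₂ : ∀ x y z : A₂, c₂ x (c₂ y z) - c₂ y (c₂ x z) = c₂ (brkt c₂ y x) z)
    (h2₂ : ∀ x y z : A₂, c₂ (brkt c₂ x y) z + c₂ (brkt c₂ y z) x + c₂ (brkt c₂ z x) y = 0)
    -- compatibility identities for (A₂,·₂,∘₂)
    (hp1₂ : ∀ x y z : A₂, 2 • m₂ (c₂ x y) z - 2 • m₂ (c₂ y x) z = m₂ y (c₂ x z) - m₂ x (c₂ y z))
    (hp2₂ : ∀ x y z : A₂, 2 • c₂ x (m₂ y z) = c₂ (m₂ z x) y + m₂ z (c₂ x y))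
    -- the bilinear extensions of the operations on the tensor product
    (M C : (A₁ ⊗[F] A₂) →ₗ[F] (A₁ ⊗[F] A₂) →ₗ[F] (A₁ ⊗[F] A₂))
    (hM : ∀ (x₁ y₁ : A₁) (x₂ y₂ : A₂),
      M (x₁ ⊗ₜ[F] x₂) (y₁ ⊗ₜ[F] y₂) = (m₁ x₁ y₁) ⊗ₜ[F] (m₂ x₂ y₂))
    (hC : ∀ (x₁ y₁ : A₁) (x₂ y₂ : A₂),
      C (x₁ ⊗ₜ[F] x₂) (y₁ ⊗ₜ[F] y₂)
        = (c₁ x₁ y₁) ⊗ₜ[F] (m₂ x₂ y₂) + (m₁ x₁ y₁) ⊗ₜ[F] (c₂ x₂ y₂)) :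
    -- (A₁⊗A₂, ·) is commutative associative
    (∀ a b : A₁ ⊗[F] A₂, M a b = M b a) ∧
    (∀ a b c : A₁ ⊗[F] A₂, M (M a b) c = M a (M b c)) ∧
    -- (A₁⊗A₂, ∘) is anti-pre-Lie
    (∀ a b c : A₁ ⊗[F] A₂, C a (C b c) - C b (C a c) = C (brkt C b a) c) ∧
    (∀ a b c : A₁ ⊗[F] A₂, C (brkt C a b) c + C (brkt C b c) a + C (brkt C c a) b = 0) ∧
    -- the compatibility identities hold on A₁⊗A₂
    (∀ a b c : A₁ ⊗[F] A₂, 2 • M (C a b) c - 2 • M (C b a) c = M b (C a c) - M a (C b c)) ∧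
    (∀ a b c : A₁ ⊗[F] A₂, 2 • C a (M b c) = C (M c a) b + M c (C a b)) := by
  have A := IsAntiPreLiePoisson.mk hm₁comm hm₁assoc h1₁ h2₁ hp1₁ hp2₁
  have B := IsAntiPreLiePoisson.mk hm₂comm hm₂assoc h1₂ h2₂ hp1₂ hp2₂
  have flip₁ (x y z : A₁) : m₁ (c₁ x y) z = m₁ z (c₁ x y) := hm₁comm _ _
  have flip₂ (x y z : A₂) : m₂ (c₂ x y) z = m₂ z (c₂ x y) := hm₂comm _ _
  refine ⟨?_, ?_, ?_, ?_, ?_, ?_⟩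
  · intro a b
    induction a with
    | zero => simp
    | add a a' ha ha' => simp [ha, ha']
    | tmul x x' =>
      induction b with
      | zero => simp
      | add b b' hb hb' => simp [hb, hb']
      | tmul y y' => rw [hM, hM, hm₁comm, hm₂comm]
  · intro a b d
    rw [← sub_eq_zero]
    refine TensorProduct.triadditive_eq_zero
      (fun a b d => M (M a b) d - M a (M b d))
      ?_ ?_ ?_ ?_ a b d
    rotate_left 3
    · intro x y z x' y' z'
      simp only [hM, hm₁assoc, hm₂assoc, sub_self]
    all_goals
      intros
      simp only [brkt, map_add, map_sub, LinearMap.add_apply, LinearMap.sub_apply, smul_add]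
      abel
  · intro a b d
    rw [← sub_eq_zero]
    refine TensorProduct.triadditive_eq_zero
      (fun a b d => C a (C b d) - C b (C a d) - C (brkt C b a) d)
      ?_ ?_ ?_ ?_ a b d
    rotate_left 3
    · intro x y z x' y' z'
      have mmA := A.mul_mul_normal_form x y z
      have mcA := A.mul_op_normal_form x y z
      have ccA := A.op_op_normal_form x y z
      have mmB := B.mul_mul_normal_form x' y' z'
      have mcB := B.mul_op_normal_form x' y' z'
      have ccB := B.op_op_normal_form x' y' z'
      simp only [brkt, hM, hC, map_add, map_sub, LinearMap.add_apply, LinearMap.sub_apply,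
        flip₁, flip₂, hm₁assoc, hm₂assoc, hm₁comm y x, hm₁comm z x, hm₁comm z y,
        hm₂comm y' x', hm₂comm z' x', hm₂comm z' y']
      simp only [mmA, mmB, mcA, mcB, ccA, ccB, TensorProduct.tmul_add, TensorProduct.add_tmul,
        TensorProduct.tmul_sub, TensorProduct.sub_tmul, TensorProduct.tmul_smul,
        ← TensorProduct.smul_tmul']
      module
    all_goals
      intros
      simp only [brkt, map_add, map_sub, LinearMap.add_apply, LinearMap.sub_apply, smul_add]
      abel
  · intro a b d
    refine TensorProduct.triadditive_eq_zero
      (fun a b d => C (brkt C a b) d + C (brkt C b d) a + C (brkt C d a) b)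
      ?_ ?_ ?_ ?_ a b d
    rotate_left 3
    · intro x y z x' y' z'
      have mmA := A.mul_mul_normal_form x y z
      have mcA := A.mul_op_normal_form x y z
      have ccA := A.op_op_normal_form x y z
      have mmB := B.mul_mul_normal_form x' y' z'
      have mcB := B.mul_op_normal_form x' y' z'
      have ccB := B.op_op_normal_form x' y' z'
      simp only [brkt, hM, hC, map_add, map_sub, LinearMap.add_apply, LinearMap.sub_apply,
        flip₁, flip₂, hm₁assoc, hm₂assoc, hm₁comm y x, hm₁comm z x, hm₁comm z y,
        hm₂comm y' x', hm₂comm z' x', hm₂comm z' y']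
      simp only [mmA, mmB, mcA, mcB, ccA, ccB, TensorProduct.tmul_add, TensorProduct.add_tmul,
        TensorProduct.tmul_sub, TensorProduct.sub_tmul, TensorProduct.tmul_smul,
        ← TensorProduct.smul_tmul']
      module
    all_goals
      intros
      simp only [brkt, map_add, map_sub, LinearMap.add_apply, LinearMap.sub_apply, smul_add]
      abel
  · intro a b d
    rw [← sub_eq_zero]
    refine TensorProduct.triadditive_eq_zero
      (fun a b d => 2 • M (C a b) d - 2 • M (C b a) d - (M b (C a d) - M a (C b d)))
      ?_ ?_ ?_ ?_ a b d
    rotate_left 3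
    · intro x y z x' y' z'
      have mmA := A.mul_mul_normal_form x y z
      have mcA := A.mul_op_normal_form x y z
      have mmB := B.mul_mul_normal_form x' y' z'
      have mcB := B.mul_op_normal_form x' y' z'
      simp only [brkt, hM, hC, map_add, map_sub, LinearMap.add_apply, LinearMap.sub_apply,
        flip₁, flip₂, hm₁assoc, hm₂assoc, hm₁comm y x, hm₁comm z x, hm₁comm z y,
        hm₂comm y' x', hm₂comm z' x', hm₂comm z' y']
      simp only [mmA, mmB, mcA, mcB, TensorProduct.tmul_add, TensorProduct.add_tmul,
        TensorProduct.tmul_sub, TensorProduct.sub_tmul, TensorProduct.tmul_smul,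
        ← TensorProduct.smul_tmul']
      module
    all_goals
      intros
      simp only [brkt, map_add, map_sub, LinearMap.add_apply, LinearMap.sub_apply, smul_add]
      abel
  · intro a b d
    rw [← sub_eq_zero]
    refine TensorProduct.triadditive_eq_zero
      (fun a b d => 2 • C a (M b d) - (C (M d a) b + M d (C a b)))
      ?_ ?_ ?_ ?_ a b d
    rotate_left 3
    · intro x y z x' y' z'
      have mmA := A.mul_mul_normal_form x y z
      have mcA := A.mul_op_normal_form x y z
      have mmB := B.mul_mul_normal_form x' y' z'
      have mcB := B.mul_op_normal_form x' y' z'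
      simp only [brkt, hM, hC, map_add, map_sub, LinearMap.add_apply, LinearMap.sub_apply,
        flip₁, flip₂, hm₁assoc, hm₂assoc, hm₁comm y x, hm₁comm z x, hm₁comm z y,
        hm₂comm y' x', hm₂comm z' x', hm₂comm z' y']
      simp only [mmA, mmB, mcA, mcB, TensorProduct.tmul_add, TensorProduct.add_tmul,
        TensorProduct.tmul_sub, TensorProduct.sub_tmul, TensorProduct.tmul_smul,
        ← TensorProduct.smul_tmul']
      module
    all_goals
      intros
      simp only [brkt, map_add, map_sub, LinearMap.add_apply, LinearMap.sub_apply, smul_add]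
      abel
end
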